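/- Let g ≥ 2 be an integer. There do not exist an integer N with N > 2(g−1), integers h ≥ 0 and l ≥ 0 with 3h − 3 + l = 3, and integers m_1, …, m_l each ≥ 2, such that 2(g−1) = N·(2h − 2 + Σ_{j=1}^{l} (1 − 1/m_j)) (the equation being between rational numbers). -/

import Mathlib

/-- A sum of `l` terms `1 - 1 / m j` with all `m j ≥ 2` is at least `l / 2`. -/
theorem half_le_sum_one_sub_inv {l : ℕ} (m : Fin l → ℕ) (hm : ∀ j, 2 ≤ m j) :
    (l : ℚ) / 2 ≤ ∑ j, (1 - 1 / (m j : ℚ)) := by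
  have hterm (j : Fin l) : (1 / 2 : ℚ) ≤ 1 - 1 / (m j : ℚ) := by
    have h2 : (2 : ℚ) ≤ m j := by exact_mod_cast hm j
    have := one_div_le_one_div_of_le two_pos h2
    linarith
  calc (l : ℚ) / 2 = ∑ _j : Fin l, (1 / 2 : ℚ) := by simp [div_eq_mul_inv]
    _ ≤ _ := Finset.sum_le_sum fun j _ => hterm j

/-- Let `g ≥ 2` be an integer. There do not exist an integer `N` with `N > 2(g−1)`,
integers `h ≥ 0` and `l ≥ 0` with `3h − 3 + l = 3`, and integers `m_1, …, m_l` each `≥ 2`,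
such that `2(g−1) = N·(2h − 2 + Σ_{j=1}^{l} (1 − 1/m_j))` (as rational numbers). -/
theorem stmt_0 (g : ℤ) (hg : 2 ≤ g) :
    ¬ ∃ (N : ℤ) (h l : ℕ) (m : Fin l → ℕ),
      2 * (g - 1) < N ∧
      3 * (h : ℤ) - 3 + (l : ℤ) = 3 ∧
      (∀ j, 2 ≤ m j) ∧
      (2 * ((g : ℚ) - 1) = (N : ℚ) * (2 * (h : ℚ) - 2 + ∑ j, (1 - 1 / (m j : ℚ)))) := by
  rintro ⟨N, h, l, m, hN, hdim, hm, hRH⟩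
  have hsum := half_le_sum_one_sub_inv m hm
  have hN' : 2 * ((g : ℚ) - 1) < N := by exact_mod_cast hN
  have hg' : (2 : ℚ) ≤ g := by exact_mod_cast hg
  have hdim' : 3 * (h : ℚ) - 3 + l = 3 := by exact_mod_cast hdim
  have hh : (0 : ℚ) ≤ h := h.cast_nonneg
  have hone : 1 ≤ 2 * (h : ℚ) - 2 + ∑ j, (1 - 1 / (m j : ℚ)) := by linarith
  have hNpos : (0 : ℚ) ≤ N := by linarith
  have := le_mul_of_one_le_right hNpos hone
  linarith
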